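/- Let q be a prime power, m, n, T, μ positive integers, k_1, …, k_{T+1} positive integers with k_1 + ⋯ + k_{T+1} = mn, let S = (S_1, …, S_{T+1}) be a random variable with S_i ∈ F_q^{k_i}, let L be uniformly distributed on the set of all bijective F_q-linear maps on F_q^{mn} independent of S, let B be a fixed (mμ) × (mn) matrix over F_q, fix 0 < ρ ≤ 1, and fix a real number C1 > 1. Then with probability at least 1 − 2(2^T − 1)/C1, a realization ℓ of L simultaneously satisfies, for all (2^T − 1) nonempty subsets 𝒾 ⊆ {1, …, T}: (i) I(S_𝒾 ; B L S^t | L = ℓ) ≤ C1 · q^{mρμ} · E[ P_{S_{𝒾̄}|S_𝒾}(S_{𝒾̄}|S_𝒾)^ρ ] / ρ, and (ii) exp( ρ · I(S_𝒾 ; B L S^t | L = ℓ) ) ≤ C1 · (1 + q^{mρμ} · E[ P_{S_{𝒾̄}|S_𝒾}(S_{𝒾̄}|S_𝒾)^ρ ]). -/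

import Mathlib

open scoped Classical
open Finset

noncomputable section

variable {Ω : Type*} [Fintype Ω]

/-- The probability P(X = x) of a random variable `X` on the finite
probability space `Ω` with probability mass function `p`. -/
def mprob {𝒳 : Type*} (p : Ω → ℝ) (X : Ω → 𝒳) (x : 𝒳) : ℝ :=
  ∑ ω, if X ω = x then p ω else 0

/-- The joint probability P(X = x, Y = y). -/
def jprob {𝒳 𝒴 : Type*} (p : Ω → ℝ) (X : Ω → 𝒳) (Y : Ω → 𝒴) (x : 𝒳) (y : 𝒴) : ℝ :=
  ∑ ω, if X ω = x ∧ Y ω = y then p ω else 0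

/-- The conditional probability P(X = x | Y = y). -/
def cprob {𝒳 𝒴 : Type*} (p : Ω → ℝ) (X : Ω → 𝒳) (Y : Ω → 𝒴) (x : 𝒳) (y : 𝒴) : ℝ :=
  jprob p X Y x y / mprob p Y y

/-- The conditional probability mass function of `p` given the event `Y = y`. -/
def condDist {𝒴 : Type*} (p : Ω → ℝ) (Y : Ω → 𝒴) (y : 𝒴) : Ω → ℝ :=
  fun ω => if Y ω = y then p ω / mprob p Y y else 0

/-- The probability of an event `E`. -/
def prEvent (p : Ω → ℝ) (E : Ω → Prop) : ℝ :=
  ∑ ω, if E ω then p ω else 0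

/-- Shannon entropy H(X) in nats. -/
def entropy {𝒳 : Type*} [Fintype 𝒳] (p : Ω → ℝ) (X : Ω → 𝒳) : ℝ :=
  -∑ x, mprob p X x * Real.log (mprob p X x)

/-- Conditional Shannon entropy H(X|Y) in nats. -/
def condEntropy {𝒳 𝒴 : Type*} [Fintype 𝒳] [Fintype 𝒴] (p : Ω → ℝ) (X : Ω → 𝒳) (Y : Ω → 𝒴) : ℝ :=
  -∑ x, ∑ y, jprob p X Y x y * Real.log (cprob p X Y x y)

/-- Shannon mutual information I(X;Y) in nats. -/
def mutInfo {𝒳 𝒴 : Type*} [Fintype 𝒳] [Fintype 𝒴] (p : Ω → ℝ) (X : Ω → 𝒳) (Y : Ω → 𝒴) : ℝ :=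
  ∑ x, ∑ y, jprob p X Y x y * Real.log (jprob p X Y x y / (mprob p X x * mprob p Y y))

/-- The expectation E[ P_{X|Y}(X|Y)^ρ ]. -/
def expPow {𝒳 𝒴 : Type*} (p : Ω → ℝ) (X : Ω → 𝒳) (Y : Ω → 𝒴) (ρ : ℝ) : ℝ :=
  ∑ ω, p ω * (cprob p X Y (X ω) (Y ω)) ^ ρ

end
/-- Concatenation of the messages `s = (s_1, …, s_{T+1})`, with `s_i ∈ F^{k_i}` and
`∑ k_i = mn`, into a single vector `S^t ∈ F^{mn}`. -/
noncomputable def concat {T m n : ℕ} {F : Type*} (k : Fin (T + 1) → ℕ)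
    (h : ∑ i, k i = m * n) (s : ∀ i, Fin (k i) → F) : Fin (m * n) → F :=
  fun j =>
    let x := (Fintype.equivFinOfCardEq
      (by simp [h] : Fintype.card (Σ i : Fin (T + 1), Fin (k i)) = m * n)).symm j
    s x.1 x.2

section FiniteProbability

variable {Ω 𝒳 𝒴 𝒵 : Type*} [Fintype Ω]

theorem mprob_nonneg {p : Ω → ℝ} (hp : ∀ ω, 0 ≤ p ω) (X : Ω → 𝒳) (x : 𝒳) :
    0 ≤ mprob p X x :=
  Finset.sum_nonneg fun ω _ => by split_ifs <;> simp [hp]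

theorem jprob_nonneg {p : Ω → ℝ} (hp : ∀ ω, 0 ≤ p ω) (X : Ω → 𝒳) (Y : Ω → 𝒴) (x : 𝒳) (y : 𝒴) :
    0 ≤ jprob p X Y x y :=
  Finset.sum_nonneg fun ω _ => by split_ifs <;> simp [hp]

theorem cprob_nonneg {p : Ω → ℝ} (hp : ∀ ω, 0 ≤ p ω) (X : Ω → 𝒳) (Y : Ω → 𝒴) (x : 𝒳) (y : 𝒴) :
    0 ≤ cprob p X Y x y :=
  div_nonneg (jprob_nonneg hp X Y x y) (mprob_nonneg hp Y y)

theorem jprob_comm (p : Ω → ℝ) (X : Ω → 𝒳) (Y : Ω → 𝒴) (x : 𝒳) (y : 𝒴) :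
    jprob p X Y x y = jprob p Y X y x := by
  simp only [jprob, and_comm]

theorem le_mprob {p : Ω → ℝ} (hp : ∀ ω, 0 ≤ p ω) (X : Ω → 𝒳) (ω : Ω) :
    p ω ≤ mprob p X (X ω) := by
  have := Finset.single_le_sum (f := fun ω' => if X ω' = X ω then p ω' else 0)
    (fun ω' _ => by split_ifs <;> simp [hp]) (Finset.mem_univ ω)
  simpa [mprob] using this

theorem le_jprob {p : Ω → ℝ} (hp : ∀ ω, 0 ≤ p ω) (X : Ω → 𝒳) (Y : Ω → 𝒴) (ω : Ω) :
    p ω ≤ jprob p X Y (X ω) (Y ω) := by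
  have := Finset.single_le_sum (f := fun ω' => if X ω' = X ω ∧ Y ω' = Y ω then p ω' else 0)
    (fun ω' _ => by split_ifs <;> simp [hp]) (Finset.mem_univ ω)
  simpa [jprob] using this

theorem sum_mprob_mul [Fintype 𝒳] (p : Ω → ℝ) (X : Ω → 𝒳) (g : 𝒳 → ℝ) :
    ∑ x, mprob p X x * g x = ∑ ω, p ω * g (X ω) := by
  simp only [mprob, Finset.sum_mul]
  rw [Finset.sum_comm]
  simp [ite_mul]

theorem sum_jprob_mul [Fintype 𝒳] [Fintype 𝒴] (p : Ω → ℝ) (X : Ω → 𝒳) (Y : Ω → 𝒴)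
    (g : 𝒳 → 𝒴 → ℝ) :
    ∑ x, ∑ y, jprob p X Y x y * g x y = ∑ ω, p ω * g (X ω) (Y ω) := by
  have h : ∀ x y, jprob p X Y x y = mprob p (fun ω => (X ω, Y ω)) (x, y) := fun x y => by
    simp only [jprob, mprob, Prod.mk.injEq]
  simp only [h]
  rw [← Fintype.sum_prod_type' (f := fun x y => mprob p (fun ω => (X ω, Y ω)) (x, y) * g x y)]
  exact sum_mprob_mul p (fun ω => (X ω, Y ω)) fun z => g z.1 z.2

theorem mutInfo_eq_sum [Fintype 𝒳] [Fintype 𝒴] (p : Ω → ℝ) (X : Ω → 𝒳) (Y : Ω → 𝒴) :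
    mutInfo p X Y = ∑ ω, p ω * Real.log (jprob p X Y (X ω) (Y ω) /
      (mprob p X (X ω) * mprob p Y (Y ω))) :=
  sum_jprob_mul p X Y fun x y => Real.log (jprob p X Y x y / (mprob p X x * mprob p Y y))

/-- A form of Gibbs' inequality. -/
theorem sum_mul_log_nonneg {p : Ω → ℝ} (hp : ∀ ω, 0 ≤ p ω) (hp1 : ∑ ω, p ω = 1) {r : Ω → ℝ}
    (hr : ∀ ω, 0 < p ω → 0 < r ω) (hsum : ∑ ω, p ω * (r ω)⁻¹ ≤ 1) :
    0 ≤ ∑ ω, p ω * Real.log (r ω) := by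
  have h : ∑ ω, (p ω - p ω * (r ω)⁻¹) ≤ ∑ ω, p ω * Real.log (r ω) := by
    refine Finset.sum_le_sum fun ω _ => ?_
    rcases (hp ω).eq_or_lt with h0 | h0
    · simp [← h0]
    · nlinarith [Real.one_sub_inv_le_log_of_pos (hr ω h0)]
  rw [Finset.sum_sub_distrib, hp1] at h
  linarith

theorem mutInfo_nonneg [Fintype 𝒳] [Fintype 𝒴] {p : Ω → ℝ} (hp : ∀ ω, 0 ≤ p ω)
    (hp1 : ∑ ω, p ω = 1) (X : Ω → 𝒳) (Y : Ω → 𝒴) : 0 ≤ mutInfo p X Y := by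
  rw [mutInfo_eq_sum]
  refine sum_mul_log_nonneg hp hp1 (fun ω h => ?_) ?_
  · exact div_pos (h.trans_le (le_jprob hp X Y ω))
      (mul_pos (h.trans_le (le_mprob hp X ω)) (h.trans_le (le_mprob hp Y ω)))
  · rw [← sum_jprob_mul p X Y fun x y => (jprob p X Y x y / (mprob p X x * mprob p Y y))⁻¹]
    have h : ∑ x, ∑ y, mprob p X x * mprob p Y y = 1 := by
      rw [← Finset.sum_mul_sum]
      have hX := sum_mprob_mul p X fun _ => 1
      have hY := sum_mprob_mul p Y fun _ => 1
      simp only [mul_one, hp1] at hX hY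
      rw [hX, hY, one_mul]
    rw [← h]
    refine Finset.sum_le_sum fun x _ => Finset.sum_le_sum fun y _ => ?_
    rw [inv_div]
    by_cases h0 : jprob p X Y x y = 0
    · rw [h0, zero_mul]
      exact mul_nonneg (mprob_nonneg hp X x) (mprob_nonneg hp Y y)
    · rw [mul_div_cancel₀ _ h0]

theorem mutInfo_le_sum_log [Fintype 𝒳] [Fintype 𝒵] {p : Ω → ℝ} (hp : ∀ ω, 0 ≤ p ω)
    (hp1 : ∑ ω, p ω = 1) (X : Ω → 𝒳) (Z : Ω → 𝒵) {A : Finset 𝒵} (hA : ∀ ω, Z ω ∈ A) :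
    mutInfo p X Z ≤ ∑ ω, p ω * Real.log (#A * cprob p Z X (Z ω) (X ω)) := by
  have : Nonempty Ω := by
    by_contra h
    simp [not_nonempty_iff.1 h] at hp1
  have hcard : (0 : ℝ) < #A := by
    exact_mod_cast Finset.card_pos.2 ⟨_, hA this.some⟩
  rw [mutInfo_eq_sum, ← sub_nonneg, ← Finset.sum_sub_distrib]
  have key : 0 ≤ ∑ ω, p ω * Real.log (#A * mprob p Z (Z ω)) := by
    refine sum_mul_log_nonneg hp hp1 (fun ω h => mul_pos hcard (h.trans_le (le_mprob hp Z ω))) ?_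
    rw [← sum_mprob_mul p Z fun z => (#A * mprob p Z z)⁻¹,
      ← Finset.sum_subset (Finset.subset_univ A)]
    · calc ∑ z ∈ A, mprob p Z z * (#A * mprob p Z z)⁻¹ ≤ ∑ z ∈ A, (#A : ℝ)⁻¹ := by
            refine Finset.sum_le_sum fun z _ => ?_
            by_cases h0 : mprob p Z z = 0
            · simp [h0]
            · rw [mul_inv, mul_comm, mul_assoc, inv_mul_cancel₀ h0, mul_one]
        _ = 1 := by rw [Finset.sum_const, nsmul_eq_mul, mul_inv_cancel₀ hcard.ne']
    · intro z _ hz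
      have : mprob p Z z = 0 := Finset.sum_eq_zero fun ω _ => if_neg (by rintro rfl; exact hz (hA ω))
      simp [this]
  refine key.trans_eq (Finset.sum_congr rfl fun ω _ => ?_)
  rcases (hp ω).eq_or_lt with h0 | h0
  · simp [← h0]
  have hX := h0.trans_le (le_mprob hp X ω)
  have hZ := h0.trans_le (le_mprob hp Z ω)
  have hJ := h0.trans_le (le_jprob hp X Z ω)
  rw [← mul_sub, cprob, jprob_comm p Z X, ← Real.log_div (by positivity) (by positivity)]
  congr 2
  field_simp

theorem exp_mul_mutInfo_le [Fintype 𝒳] [Fintype 𝒵] {p : Ω → ℝ} (hp : ∀ ω, 0 ≤ p ω)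
    (hp1 : ∑ ω, p ω = 1) (X : Ω → 𝒳) (Z : Ω → 𝒵) {A : Finset 𝒵} (hA : ∀ ω, Z ω ∈ A)
    {ρ : ℝ} (hρ : 0 ≤ ρ) :
    Real.exp (ρ * mutInfo p X Z) ≤ ∑ ω, p ω * (#A * cprob p Z X (Z ω) (X ω)) ^ ρ := by
  calc Real.exp (ρ * mutInfo p X Z)
      ≤ Real.exp (∑ ω, p ω • (Real.log (#A * cprob p Z X (Z ω) (X ω)) * ρ)) := by
        refine Real.exp_le_exp.2 ((mul_le_mul_of_nonneg_left
          (mutInfo_le_sum_log hp hp1 X Z hA) hρ).trans_eq ?_)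
        rw [Finset.mul_sum]
        exact Finset.sum_congr rfl fun ω _ => by rw [smul_eq_mul]; ring
    _ ≤ ∑ ω, p ω • Real.exp (Real.log (#A * cprob p Z X (Z ω) (X ω)) * ρ) :=
        convexOn_exp.map_sum_le (fun ω _ => hp ω) hp1 fun _ _ => Set.mem_univ _
    _ = ∑ ω, p ω * (#A * cprob p Z X (Z ω) (X ω)) ^ ρ := by
        refine Finset.sum_congr rfl fun ω _ => ?_
        rcases (hp ω).eq_or_lt with h0 | h0
        · simp [← h0]
        have hX := h0.trans_le (le_mprob hp X ω)
        have hJ := h0.trans_le (le_jprob hp Z X ω)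
        have hA' : (0 : ℝ) < #A := by exact_mod_cast Finset.card_pos.2 ⟨_, hA ω⟩
        have hc : 0 < cprob p Z X (Z ω) (X ω) := div_pos hJ hX
        rw [smul_eq_mul, Real.rpow_def_of_pos (mul_pos hA' hc)]

/-- If a random map `Z g`, with `g` drawn with weights `w`, identifies outcomes that agree in `X`
but not in `Y` with probability at most `1 / #A`, then on average it leaks little about `X`. -/
theorem sum_mul_exp_mutInfo_le {G : Type*} [Fintype G] [Fintype 𝒳] [Fintype 𝒵] {p : Ω → ℝ}
    (hp : ∀ ω, 0 ≤ p ω) (hp1 : ∑ ω, p ω = 1) {w : G → ℝ} (hw : ∀ g, 0 ≤ w g)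
    (hw1 : ∑ g, w g = 1) (X : Ω → 𝒳) (Y : Ω → 𝒴) (Z : G → Ω → 𝒵) {A : Finset 𝒵}
    (hA : ∀ g ω, Z g ω ∈ A)
    (hcoll : ∀ ω ω', X ω' = X ω → Y ω' ≠ Y ω →
      #A * ∑ g, (if Z g ω' = Z g ω then w g else 0) ≤ 1)
    {ρ : ℝ} (hρ0 : 0 ≤ ρ) (hρ1 : ρ ≤ 1) :
    ∑ g, w g * Real.exp (ρ * mutInfo p X (Z g)) ≤ 1 + (#A : ℝ) ^ ρ * expPow p Y X ρ := by
  have key : ∀ ω, 0 < p ω → ∑ g, w g * (#A * cprob p (Z g) X (Z g ω) (X ω)) ≤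
      1 + #A * cprob p Y X (Y ω) (X ω) := by
    intro ω h0
    have hX := h0.trans_le (le_mprob hp X ω)
    have hw0 : ∀ ω', ∑ g, (if Z g ω' = Z g ω then w g else 0) ≤ 1 := fun ω' =>
      (Finset.sum_le_sum fun g _ => by split_ifs <;> simp [hw]).trans_eq hw1
    have hswap : ∑ g, w g * (#A * cprob p (Z g) X (Z g ω) (X ω)) =
        (∑ ω', (if X ω' = X ω then p ω' else 0) *
          (#A * ∑ g, (if Z g ω' = Z g ω then w g else 0))) / mprob p X (X ω) := by
      simp only [cprob, jprob, Finset.mul_sum, Finset.sum_div]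
      rw [Finset.sum_comm]
      refine Finset.sum_congr rfl fun ω' _ => Finset.sum_congr rfl fun g _ => ?_
      by_cases h1 : X ω' = X ω <;> by_cases h2 : Z g ω' = Z g ω <;> simp [h1, h2]
      ring
    rw [hswap, div_le_iff₀ hX, cprob, add_mul, one_mul, mul_assoc, div_mul_cancel₀ _ hX.ne',
      mprob, jprob, Finset.mul_sum, ← Finset.sum_add_distrib]
    refine Finset.sum_le_sum fun ω' _ => ?_
    by_cases h1 : X ω' = X ω
    · by_cases h2 : Y ω' = Y ω
      · simp only [h1, h2, and_self, if_true]
        nlinarith [hp ω', mul_le_mul_of_nonneg_left (hw0 ω')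
          (mul_nonneg (hp ω') (Nat.cast_nonneg (α := ℝ) #A))]
      · simp only [h1, h2, and_true, if_true, if_false, mul_zero, add_zero]
        exact mul_le_of_le_one_right (hp ω') (hcoll ω ω' h1 h2)
    · simp [h1]
  calc ∑ g, w g * Real.exp (ρ * mutInfo p X (Z g))
      ≤ ∑ g, w g * ∑ ω, p ω * (#A * cprob p (Z g) X (Z g ω) (X ω)) ^ ρ :=
        Finset.sum_le_sum fun g _ =>
          mul_le_mul_of_nonneg_left (exp_mul_mutInfo_le hp hp1 X (Z g) (hA g) hρ0) (hw g)
    _ = ∑ ω, p ω * ∑ g, w g • (#A * cprob p (Z g) X (Z g ω) (X ω)) ^ ρ := by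
        simp only [Finset.mul_sum, smul_eq_mul]
        rw [Finset.sum_comm]
        exact Finset.sum_congr rfl fun ω _ => Finset.sum_congr rfl fun g _ => by ring
    _ ≤ ∑ ω, p ω * (1 + (#A : ℝ) ^ ρ * cprob p Y X (Y ω) (X ω) ^ ρ) := by
        refine Finset.sum_le_sum fun ω _ => ?_
        rcases (hp ω).eq_or_lt with h0 | h0
        · simp [← h0]
        refine mul_le_mul_of_nonneg_left ?_ (hp ω)
        have hc := cprob_nonneg hp Y X (Y ω) (X ω)
        have hc' := fun g => mul_nonneg (Nat.cast_nonneg (α := ℝ) #A)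
          (cprob_nonneg hp (Z g) X (Z g ω) (X ω))
        calc ∑ g, w g • (#A * cprob p (Z g) X (Z g ω) (X ω)) ^ ρ
            ≤ (∑ g, w g • (#A * cprob p (Z g) X (Z g ω) (X ω))) ^ ρ :=
              (Real.concaveOn_rpow hρ0 hρ1).le_map_sum (fun g _ => hw g) hw1 fun g _ => hc' g
          _ ≤ (1 + #A * cprob p Y X (Y ω) (X ω)) ^ ρ :=
              Real.rpow_le_rpow (Finset.sum_nonneg fun g _ => mul_nonneg (hw g) (hc' g))
                (key ω h0) hρ0
          _ ≤ 1 ^ ρ + (#A * cprob p Y X (Y ω) (X ω)) ^ ρ :=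
              Real.rpow_add_le_add_rpow zero_le_one (by positivity) hρ0 hρ1
          _ = 1 + (#A : ℝ) ^ ρ * cprob p Y X (Y ω) (X ω) ^ ρ := by
              rw [Real.one_rpow, Real.mul_rpow (Nat.cast_nonneg _) hc]
    _ = 1 + (#A : ℝ) ^ ρ * expPow p Y X ρ := by
        simp only [mul_add, Finset.sum_add_distrib, mul_one, hp1, expPow, Finset.mul_sum]
        congr 1
        exact Finset.sum_congr rfl fun ω _ => by ring

theorem expPow_pos {p : Ω → ℝ} (hp : ∀ ω, 0 ≤ p ω) (hp1 : ∑ ω, p ω = 1) (X : Ω → 𝒳) (Y : Ω → 𝒴)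
    (ρ : ℝ) : 0 < expPow p X Y ρ := by
  have hnn : ∀ ω, 0 ≤ p ω * cprob p X Y (X ω) (Y ω) ^ ρ := fun ω =>
    mul_nonneg (hp ω) (Real.rpow_nonneg (cprob_nonneg hp X Y _ _) _)
  obtain ⟨ω, h0⟩ : ∃ ω, 0 < p ω := by
    by_contra! h
    have := Finset.sum_nonpos fun ω (_ : ω ∈ Finset.univ) => h ω
    linarith
  refine Finset.sum_pos' (fun ω _ => hnn ω) ⟨ω, Finset.mem_univ ω, mul_pos h0 ?_⟩
  exact Real.rpow_pos_of_pos (div_pos (h0.trans_le (le_jprob hp X Y ω))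
    (h0.trans_le (le_mprob hp Y ω))) ρ

theorem markov_sum_ite_le {G : Type*} [Fintype G] {w f : G → ℝ} (hw : ∀ g, 0 ≤ w g)
    (hf : ∀ g, 0 ≤ f g) {a C : ℝ} (ha : 0 < a) (hC : 0 < C) (hmean : ∑ g, w g * f g ≤ a) :
    ∑ g, (if f g ≤ C * a then 0 else w g) ≤ 1 / C := by
  rw [le_div_iff₀ hC, Finset.sum_mul, ← mul_le_mul_iff_left₀ ha, Finset.sum_mul, one_mul]
  refine (Finset.sum_le_sum fun g _ => ?_).trans hmean
  split_ifs with h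
  · simpa using mul_nonneg (hw g) (hf g)
  · rw [mul_assoc]
    exact mul_le_mul_of_nonneg_left (not_le.1 h).le (hw g)

theorem one_sub_card_mul_le_sum_ite_forall {G ι : Type*} [Fintype G] {w : G → ℝ}
    (hw : ∀ g, 0 ≤ w g) (hw1 : ∑ g, w g = 1) (s : Finset ι) (P : ι → G → Prop) {δ : ℝ}
    (h : ∀ i ∈ s, ∑ g, (if P i g then 0 else w g) ≤ δ) :
    1 - #s * δ ≤ ∑ g, if ∀ i ∈ s, P i g then w g else 0 := by
  have hsum : ∑ g, ∑ i ∈ s, (if P i g then 0 else w g) ≤ #s * δ := by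
    rw [Finset.sum_comm, ← nsmul_eq_mul]
    exact Finset.sum_le_card_nsmul s _ δ h
  rw [← hw1]
  refine (sub_le_sub_left hsum _).trans ?_
  rw [← Finset.sum_sub_distrib]
  refine Finset.sum_le_sum fun g _ => ?_
  have hnn : ∀ i ∈ s, 0 ≤ if P i g then 0 else w g := fun i _ => by split_ifs <;> simp [hw]
  split_ifs with hall
  · exact sub_le_self _ (Finset.sum_nonneg hnn)
  · push Not at hall
    obtain ⟨i, hi, hPi⟩ := hall
    have := Finset.single_le_sum hnn hi
    rw [if_neg hPi] at this
    linarith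

section condDist

variable {𝒮 ℒ : Type*} [Fintype 𝒮] {p : Ω → ℝ} {S : Ω → 𝒮} {L : Ω → ℒ} {ℓ : ℒ}

theorem sum_condDist_mul (hL : mprob p L ℓ ≠ 0)
    (hSL : ∀ s, jprob p S L s ℓ = mprob p S s * mprob p L ℓ) (f : 𝒮 → ℝ) :
    ∑ ω, condDist p L ℓ ω * f (S ω) = ∑ ω, p ω * f (S ω) := by
  rw [← sum_mprob_mul (condDist p L ℓ) S f, ← sum_mprob_mul p S f]
  refine Finset.sum_congr rfl fun s _ => ?_
  rw [eq_div_of_mul_eq hL (hSL s).symm]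
  simp only [mprob, jprob, condDist, Finset.sum_div]
  congr 1
  refine Finset.sum_congr rfl fun ω _ => ?_
  by_cases h1 : S ω = s <;> by_cases h2 : L ω = ℓ <;> simp [h1, h2]

theorem mutInfo_condDist [Fintype 𝒳] [Fintype 𝒵] (hL : mprob p L ℓ ≠ 0)
    (hSL : ∀ s, jprob p S L s ℓ = mprob p S s * mprob p L ℓ) (ψ : 𝒮 → 𝒳) (φ : 𝒮 → 𝒵)
    (Z : Ω → 𝒵) (hZ : ∀ ω, L ω = ℓ → Z ω = φ (S ω)) :
    mutInfo (condDist p L ℓ) (fun ω => ψ (S ω)) Z =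
      mutInfo p (fun ω => ψ (S ω)) fun ω => φ (S ω) := by
  have hX : ∀ x, mprob (condDist p L ℓ) (fun ω => ψ (S ω)) x = mprob p (fun ω => ψ (S ω)) x := by
    intro x
    simpa [mprob] using sum_condDist_mul hL hSL fun s => if ψ s = x then 1 else 0
  have hZ' : ∀ z, mprob (condDist p L ℓ) Z z = mprob p (fun ω => φ (S ω)) z := by
    intro z
    have := sum_condDist_mul hL hSL fun s => if φ s = z then 1 else 0
    simp only [mul_ite, mul_one, mul_zero] at this
    rw [mprob, mprob, ← this]
    refine Finset.sum_congr rfl fun ω _ => ?_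
    by_cases h : L ω = ℓ
    · rw [hZ ω h]
    · simp [condDist, h]
  have hJ : ∀ x z, jprob (condDist p L ℓ) (fun ω => ψ (S ω)) Z x z =
      jprob p (fun ω => ψ (S ω)) (fun ω => φ (S ω)) x z := by
    intro x z
    have := sum_condDist_mul hL hSL fun s => if ψ s = x ∧ φ s = z then 1 else 0
    simp only [mul_ite, mul_one, mul_zero] at this
    rw [jprob, jprob, ← this]
    refine Finset.sum_congr rfl fun ω _ => ?_
    by_cases h : L ω = ℓ
    · rw [hZ ω h]
    · simp [condDist, h]
  simp only [mutInfo, hX, hZ', hJ]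

end condDist

end FiniteProbability

section GeneralLinearGroup

variable {F ι κ : Type*} [Field F] [Fintype ι] [DecidableEq ι]

theorem exists_generalLinearGroup_mulVec_eq {v w : ι → F} (hv : v ≠ 0) (hw : w ≠ 0) :
    ∃ g : GL ι F, (g : Matrix ι ι F).mulVec v = w := by
  let ev := LinearEquiv.toSpanNonzeroSingleton F (ι → F) v hv
  let ew := LinearEquiv.toSpanNonzeroSingleton F (ι → F) w hw
  obtain ⟨g, hg⟩ := Submodule.exists_linearEquiv_restrict_eq (ev.symm ≪≫ₗ ew)
  refine ⟨Matrix.GeneralLinearGroup.toLin.symm (LinearMap.GeneralLinearGroup.ofLinearEquiv g), ?_⟩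
  have h1 : g v = w := by
    have := hg (ev 1)
    rw [LinearEquiv.trans_apply, LinearEquiv.symm_apply_apply] at this
    simpa [ev, ew] using this.symm
  rw [← h1, ← Matrix.mulVecLin_apply, ← Matrix.GeneralLinearGroup.coe_toLin, MulEquiv.apply_symm_apply]
  rfl

variable [Fintype F] [DecidableEq F]

theorem card_filter_mulVec_eq {v w : ι → F} (hv : v ≠ 0) (hw : w ≠ 0) :
    #{ℓ : GL ι F | (ℓ : Matrix ι ι F).mulVec v = w} =
      #{ℓ : GL ι F | (ℓ : Matrix ι ι F).mulVec v = v} := by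
  obtain ⟨g, hg⟩ := exists_generalLinearGroup_mulVec_eq hv hw
  symm
  refine Finset.card_equiv (Equiv.mulLeft g) fun ℓ => ?_
  simp only [Finset.mem_filter, Finset.mem_univ, true_and, Equiv.coe_mulLeft, Units.val_mul,
    ← Matrix.mulVec_mulVec]
  rw [← hg]
  exact (Matrix.mulVec_injective_of_isUnit g.isUnit).eq_iff.symm

variable [Fintype κ]

theorem card_image_mulVec_mul_card_ker (B : Matrix κ ι F) :
    #(Finset.univ.image B.mulVec) * #{w | B.mulVec w = 0} = Fintype.card (ι → F) := by
  have h := B.mulVecLin.toAddMonoidHom.ker.card_mul_index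
  rw [AddSubgroup.index_ker, mul_comm, Nat.card_eq_fintype_card (α := ι → F)] at h
  rw [← h]
  congr 1
  · rw [← Set.toFinset_range, Set.toFinset_card, ← Nat.card_eq_fintype_card]
    rfl
  · rw [← Fintype.card_subtype, ← Nat.card_eq_fintype_card]
    rfl

/-- A uniformly random invertible matrix sends a fixed nonzero vector into the kernel of `B` with
probability at most the reciprocal of the size of the range of `B`. -/
theorem card_image_mulVec_mul_card_filter_le (B : Matrix κ ι F) {v : ι → F} (hv : v ≠ 0) :
    #(Finset.univ.image B.mulVec) *
      #{ℓ : GL ι F | B.mulVec ((ℓ : Matrix ι ι F).mulVec v) = 0} ≤ Fintype.card (GL ι F) := by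
  have hne : ∀ ℓ : GL ι F, (ℓ : Matrix ι ι F).mulVec v ≠ 0 := fun ℓ h =>
    hv (Matrix.mulVec_injective_of_isUnit ℓ.isUnit (h.trans (Matrix.mulVec_zero _).symm))
  set c := #{ℓ : GL ι F | (ℓ : Matrix ι ι F).mulVec v = v} with hc
  have hall : Fintype.card (GL ι F) = (Fintype.card (ι → F) - 1) * c := by
    rw [← Finset.card_univ, Finset.card_eq_sum_card_fiberwise
      (f := fun ℓ : GL ι F => (ℓ : Matrix ι ι F).mulVec v) (t := Finset.univ.erase 0)
      (fun ℓ _ => by simpa using hne ℓ),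
      Finset.sum_congr rfl fun w hw => card_filter_mulVec_eq hv (Finset.ne_of_mem_erase hw),
      Finset.sum_const, smul_eq_mul, Finset.card_erase_of_mem (Finset.mem_univ _),
      Finset.card_univ]
  have hker : #{ℓ : GL ι F | B.mulVec ((ℓ : Matrix ι ι F).mulVec v) = 0} =
      (#{w | B.mulVec w = 0} - 1) * c := by
    rw [Finset.card_eq_sum_card_fiberwise
      (f := fun ℓ : GL ι F => (ℓ : Matrix ι ι F).mulVec v)
      (t := Finset.erase {w | B.mulVec w = 0} 0)
      (fun ℓ hℓ => by simpa [hne ℓ] using hℓ)]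
    rw [← Finset.card_erase_of_mem (a := (0 : ι → F)) (by simp), ← smul_eq_mul,
      ← Finset.sum_const]
    refine Finset.sum_congr rfl fun w hw => ?_
    rw [hc, ← card_filter_mulVec_eq hv (Finset.ne_of_mem_erase hw), Finset.filter_filter]
    congr 1
    refine Finset.filter_congr fun ℓ _ => ?_
    have hw' : B.mulVec w = 0 := by simpa using Finset.mem_of_mem_erase hw
    exact ⟨fun h => h.2, fun h => ⟨h ▸ hw', h⟩⟩
  have hA : 1 ≤ #(Finset.univ.image B.mulVec) :=
    Finset.card_pos.2 (Finset.univ_nonempty.image _)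
  rw [hall, hker, ← mul_assoc, Nat.mul_sub_one, card_image_mulVec_mul_card_ker]
  gcongr

end GeneralLinearGroup

theorem concat_injective {T m n : ℕ} {F : Type*} (k : Fin (T + 1) → ℕ) (h : ∑ i, k i = m * n) :
    Function.Injective (concat (F := F) k h) := by
  intro s s' hs
  have hsigma : ∀ x : Σ i, Fin (k i), s x.1 x.2 = s' x.1 x.2 := fun x => by
    obtain ⟨j, rfl⟩ := (Fintype.equivFinOfCardEq
      (by simp [h] : Fintype.card (Σ i : Fin (T + 1), Fin (k i)) = m * n)).symm.surjective x
    exact congrFun hs j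
  exact funext fun i => funext fun j => hsigma ⟨i, j⟩

/-- With probability at least `1 − 2(2^T − 1)/C1` over the
uniform choice of `L`, a realization `ℓ` simultaneously satisfies, for all
nonempty subsets `𝒾 ⊆ {1, …, T}`:
(i) `I(S_𝒾 ; BLSᵗ | L = ℓ) ≤ C1·q^{mρμ}·E[P_{S_𝒾̄|S_𝒾}^ρ]/ρ`, and
(ii) `exp(ρ·I(S_𝒾 ; BLSᵗ | L = ℓ)) ≤ C1·(1 + q^{mρμ}·E[P_{S_𝒾̄|S_𝒾}^ρ])`. -/
theorem good_realization_probability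
    {F : Type*} [Field F] [Fintype F] [DecidableEq F]
    (m n T μ : ℕ) (hm : 0 < m) (hn : 0 < n) (hT : 0 < T) (hμ : 0 < μ)
    (k : Fin (T + 1) → ℕ) (hkpos : ∀ i, 0 < k i) (hk : ∑ i, k i = m * n)
    {Ω : Type*} [Fintype Ω] (p : Ω → ℝ) (hp0 : ∀ ω, 0 ≤ p ω) (hp1 : ∑ ω, p ω = 1)
    (S : Ω → (∀ i : Fin (T + 1), Fin (k i) → F))
    (L : Ω → GL (Fin (m * n)) F)
    -- L is uniformly distributed
    (hLunif : ∀ ℓ, mprob p L ℓ = 1 / (Nat.card (GL (Fin (m * n)) F) : ℝ))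
    -- L is statistically independent of S
    (hLS : ∀ s ℓ, jprob p S L s ℓ = mprob p S s * mprob p L ℓ)
    (B : Matrix (Fin (m * μ)) (Fin (m * n)) F)
    (ρ : ℝ) (hρ0 : 0 < ρ) (hρ1 : ρ ≤ 1) (C1 : ℝ) (hC1 : 1 < C1) :
    (∑ ℓ : GL (Fin (m * n)) F,
        if (∀ 𝒾 : Finset (Fin (T + 1)), 𝒾.Nonempty → Fin.last T ∉ 𝒾 →
            (mutInfo (condDist p L ℓ)
                (fun ω => fun i : 𝒾 => S ω i.1)
                (fun ω => B.mulVec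
                  (((L ω : Matrix (Fin (m * n)) (Fin (m * n)) F)).mulVec
                    (concat k hk (S ω))))
              ≤ C1 * (Fintype.card F : ℝ) ^ ((m : ℝ) * ρ * (μ : ℝ)) *
                  expPow p (fun ω => fun i : (𝒾ᶜ : Finset (Fin (T + 1))) => S ω i.1)
                    (fun ω => fun i : 𝒾 => S ω i.1) ρ / ρ)
            ∧ (Real.exp (ρ * mutInfo (condDist p L ℓ)
                (fun ω => fun i : 𝒾 => S ω i.1)
                (fun ω => B.mulVec
                  (((L ω : Matrix (Fin (m * n)) (Fin (m * n)) F)).mulVec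
                    (concat k hk (S ω)))))
              ≤ C1 * (1 + (Fintype.card F : ℝ) ^ ((m : ℝ) * ρ * (μ : ℝ)) *
                  expPow p (fun ω => fun i : (𝒾ᶜ : Finset (Fin (T + 1))) => S ω i.1)
                    (fun ω => fun i : 𝒾 => S ω i.1) ρ)))
        then mprob p L ℓ else 0)
      ≥ 1 - 2 * ((2 : ℝ) ^ T - 1) / C1 := by
  have hcard : (0 : ℝ) < Nat.card (GL (Fin (m * n)) F) := by exact_mod_cast Nat.card_pos
  have hLpos : ∀ ℓ, 0 < mprob p L ℓ := fun ℓ => by rw [hLunif]; positivity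
  have hL1 : ∑ ℓ, mprob p L ℓ = 1 := by
    simpa [hp1] using sum_mprob_mul p L fun _ => 1
  set sets := ((Finset.univ.erase (Fin.last T)).powerset.erase ∅) with hsets
  have hmem : ∀ 𝒾, 𝒾 ∈ sets ↔ 𝒾.Nonempty ∧ Fin.last T ∉ 𝒾 := fun 𝒾 => by
    simp [hsets, Finset.nonempty_iff_ne_empty, Finset.subset_erase]
  have hcount : (#sets : ℝ) = 2 ^ T - 1 := by
    rw [Finset.card_erase_of_mem (by simp), Finset.card_powerset,
      Finset.card_erase_of_mem (Finset.mem_univ _), Finset.card_univ, Fintype.card_fin,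
      Nat.add_sub_cancel, Nat.cast_sub Nat.one_le_two_pow]
    norm_num
  set A : Finset (Fin (m * μ) → F) := Finset.univ.image B.mulVec
  set Q : ℝ := (Fintype.card F : ℝ) ^ ((m : ℝ) * ρ * (μ : ℝ)) with hQ
  have hAQ : (#A : ℝ) ^ ρ ≤ Q := by
    have h1 : (#A : ℝ) ≤ (Fintype.card F : ℝ) ^ ((m : ℝ) * μ) := by
      have : #A ≤ Fintype.card F ^ (m * μ) := by
        simpa using Finset.card_le_univ A
      exact_mod_cast this
    calc (#A : ℝ) ^ ρ ≤ ((Fintype.card F : ℝ) ^ ((m : ℝ) * μ)) ^ ρ :=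
          Real.rpow_le_rpow (Nat.cast_nonneg _) h1 hρ0.le
      _ = Q := by rw [← Real.rpow_mul (Nat.cast_nonneg _), hQ]; congr 1; ring
  have hQpos : 0 < Q := Real.rpow_pos_of_pos (by exact_mod_cast Fintype.card_pos) _
  have hcoll : ∀ s s' : ∀ i : Fin (T + 1), Fin (k i) → F, s' ≠ s →
      #A * ∑ ℓ : GL (Fin (m * n)) F,
        (if B.mulVec ((ℓ : Matrix _ _ F).mulVec (concat k hk s')) =
          B.mulVec ((ℓ : Matrix _ _ F).mulVec (concat k hk s)) then mprob p L ℓ else 0) ≤ 1 := by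
    intro s s' hne
    have h := card_image_mulVec_mul_card_filter_le B
      (sub_ne_zero.2 fun h => hne (concat_injective k hk h))
    simp only [Matrix.mulVec_sub, sub_eq_zero] at h
    simp only [hLunif]
    rw [← Finset.sum_filter, Finset.sum_const, nsmul_eq_mul, mul_one_div, ← mul_div_assoc,
      div_le_one hcard, Nat.card_eq_fintype_card]
    exact_mod_cast h
  have hcond : ∀ (𝒾 : Finset (Fin (T + 1))) (ℓ : GL (Fin (m * n)) F), _ := fun 𝒾 ℓ =>
    mutInfo_condDist (hLpos ℓ).ne' (fun s => hLS s ℓ) (fun s => fun i : 𝒾 => s i.1)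
      (fun s => B.mulVec ((ℓ : Matrix (Fin (m * n)) (Fin (m * n)) F).mulVec (concat k hk s)))
      (fun ω => B.mulVec ((L ω : Matrix (Fin (m * n)) (Fin (m * n)) F).mulVec (concat k hk (S ω))))
      (fun ω h => by rw [h])
  simp only [hcond]
  set I : Finset (Fin (T + 1)) → GL (Fin (m * n)) F → ℝ := fun 𝒾 ℓ =>
    mutInfo p (fun ω => fun i : 𝒾 => S ω i.1)
      (fun ω => B.mulVec ((ℓ : Matrix (Fin (m * n)) (Fin (m * n)) F).mulVec (concat k hk (S ω))))
    with hI
  set E : Finset (Fin (T + 1)) → ℝ := fun 𝒾 =>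
    expPow p (fun ω => fun i : (𝒾ᶜ : Finset (Fin (T + 1))) => S ω i.1)
      (fun ω => fun i : 𝒾 => S ω i.1) ρ with hE
  have hEpos : ∀ 𝒾, 0 < E 𝒾 := fun 𝒾 => expPow_pos hp0 hp1 _ _ ρ
  have hInonneg : ∀ 𝒾 ℓ, 0 ≤ I 𝒾 ℓ := fun 𝒾 ℓ => mutInfo_nonneg hp0 hp1 _ _
  have hexp : ∀ 𝒾, ∑ ℓ, mprob p L ℓ * Real.exp (ρ * I 𝒾 ℓ) ≤ 1 + Q * E 𝒾 := fun 𝒾 =>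
    (sum_mul_exp_mutInfo_le hp0 hp1 (fun ℓ => (hLpos ℓ).le) hL1 (fun ω => fun i : 𝒾 => S ω i.1)
      (fun ω => fun i : (𝒾ᶜ : Finset (Fin (T + 1))) => S ω i.1)
      (fun ℓ ω => B.mulVec ((ℓ : Matrix (Fin (m * n)) (Fin (m * n)) F).mulVec (concat k hk (S ω))))
      (A := A) (fun ℓ ω => Finset.mem_image_of_mem _ (Finset.mem_univ _))
      (fun ω ω' _ hY => by
        convert hcoll (S ω) (S ω') fun h => hY (by rw [h])) hρ0.le hρ1).trans
      (add_le_add_right (mul_le_mul_of_nonneg_right hAQ (hEpos 𝒾).le) 1)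
  have hmean : ∀ 𝒾, ∑ ℓ, mprob p L ℓ * I 𝒾 ℓ ≤ Q * E 𝒾 / ρ := fun 𝒾 => by
    have h : ∑ ℓ, (mprob p L ℓ + mprob p L ℓ * I 𝒾 ℓ * ρ) ≤ 1 + Q * E 𝒾 :=
      (Finset.sum_le_sum fun ℓ _ => by
        nlinarith [mul_le_mul_of_nonneg_left (Real.add_one_le_exp (ρ * I 𝒾 ℓ))
          (hLpos ℓ).le]).trans (hexp 𝒾)
    rw [Finset.sum_add_distrib, hL1, ← Finset.sum_mul] at h
    rw [le_div_iff₀ hρ0]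
    linarith
  have hC : 0 < C1 := one_pos.trans hC1
  have hbound := one_sub_card_mul_le_sum_ite_forall (fun ℓ => (hLpos ℓ).le) hL1 sets
    (fun 𝒾 ℓ => I 𝒾 ℓ ≤ C1 * Q * E 𝒾 / ρ ∧ Real.exp (ρ * I 𝒾 ℓ) ≤ C1 * (1 + Q * E 𝒾))
    (δ := 2 / C1) fun 𝒾 _ => by
      have hQE := mul_pos hQpos (hEpos 𝒾)
      have h1 := markov_sum_ite_le (fun ℓ => (hLpos ℓ).le) (hInonneg 𝒾) (div_pos hQE hρ0) hC
        (hmean 𝒾)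
      have h2 := markov_sum_ite_le (fun ℓ => (hLpos ℓ).le)
        (fun ℓ => (Real.exp_pos (ρ * I 𝒾 ℓ)).le) (add_pos one_pos hQE) hC (hexp 𝒾)
      rw [← one_add_one_eq_two, add_div]
      refine le_trans ?_ (add_le_add h1 h2)
      rw [← Finset.sum_add_distrib]
      refine Finset.sum_le_sum fun ℓ _ => ?_
      rw [← mul_div_assoc, ← mul_assoc]
      have := (hLpos ℓ).le
      split_ifs <;> first | linarith | tauto
  rw [ge_iff_le, mul_comm 2, mul_div_assoc, ← hcount]
  refine hbound.trans_eq (Finset.sum_congr rfl fun ℓ _ => ?_)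
  simp only [hmem, and_imp, hI, hE]
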